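/- Let (Σ_M, σ) be an irreducible topological Markov chain with ultrametric d_λ, λ > 1, Q a periodic orbit, and G^s(Q) the stable groupoid. Let c ∈ G^s(Q) and let n ≥ c_s(c) be an integer. Then for all a, b ∈ V^s(c, λ^{−n−1}, n) one has D_{s,λ}(a,b) ≤ λ^{−n−1}. -/

import Mathlib

open scoped Classical

/-- A sequence `x : ℤ → Fin m` is allowable for the 0-1 matrix `M` if all its
transitions are allowed. -/
def IsMarkov {m : ℕ} (M : Fin m → Fin m → Bool) (x : ℤ → Fin m) : Prop :=
  ∀ i : ℤ, M (x i) (x (i + 1)) = true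

/-- The topological Markov chain `Σ_M` of allowable bi-infinite sequences. -/
def TMC {m : ℕ} (M : Fin m → Fin m → Bool) : Type := {x : ℤ → Fin m // IsMarkov M x}

namespace TMC

variable {m : ℕ} {M : Fin m → Fin m → Bool}

instance : TopologicalSpace (TMC M) :=
  inferInstanceAs (TopologicalSpace {x : ℤ → Fin m // IsMarkov M x})

/-- The shift homeomorphism `σ(x)_i = x_{i+1}`. -/
def shift (M : Fin m → Fin m → Bool) (x : TMC M) : TMC M :=
  ⟨fun i => x.1 (i + 1), fun i => x.2 (i + 1)⟩

/-- The inverse shift `σ⁻¹(x)_i = x_{i-1}`. -/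
def shiftInv (M : Fin m → Fin m → Bool) (x : TMC M) : TMC M :=
  ⟨fun i => x.1 (i - 1), fun i => by
    have h : i + 1 - 1 = i - 1 + 1 := by ring
    show M (x.1 (i - 1)) (x.1 (i + 1 - 1)) = true
    rw [h]
    exact x.2 (i - 1)⟩

/-- The ultrametric `d_λ(x,y) = inf{λ^{-n} : n ≥ 0, xᵢ = yᵢ for |i| < n}`. -/
noncomputable def dlam (lam : ℝ) (x y : TMC M) : ℝ :=
  sInf {r : ℝ | ∃ n : ℕ, (∀ i : ℤ, |i| < (n : ℤ) → x.1 i = y.1 i) ∧ r = lam ^ (-(n : ℤ))}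

/-- The bracket (splicing) map: `[x,y]_n = y_n` for `n ≤ 0` and `[x,y]_n = x_n` for
`n ≥ 1`, defined when `x₀ = y₀` (junk value `x` otherwise). -/
noncomputable def bracket (x y : TMC M) : TMC M :=
  if h : x.1 0 = y.1 0 then
    ⟨fun n => if n ≤ 0 then y.1 n else x.1 n, by
      intro i
      by_cases h1 : i + 1 ≤ 0
      · have h2 : i ≤ 0 := by omega
        simp only [if_pos h1, if_pos h2]
        exact y.2 i
      · by_cases h2 : i ≤ 0
        · have h3 : i = 0 := by omega
          subst h3
          simp only [if_neg h1, le_refl, if_pos]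
          rw [← h]
          exact x.2 0
        · simp only [if_neg h1, if_neg h2]
          exact x.2 i⟩
  else x

/-- The local stable set `X^s(x,ε) = {y : d_λ(x,y) < ε, [x,y] = y}`. -/
def locStable (lam : ℝ) (x : TMC M) (ε : ℝ) : Set (TMC M) :=
  {y | dlam lam x y < ε ∧ bracket x y = y}

/-- The local unstable set `X^u(x,ε) = {y : d_λ(x,y) < ε, [y,x] = y}`. -/
def locUnstable (lam : ℝ) (x : TMC M) (ε : ℝ) : Set (TMC M) :=
  {y | dlam lam x y < ε ∧ bracket y x = y}

/-- The global stable set `X^s(x) = {y : d_λ(σⁿx, σⁿy) → 0 as n → +∞}`. -/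
def globStable (lam : ℝ) (x : TMC M) : Set (TMC M) :=
  {y | Filter.Tendsto (fun n : ℕ => dlam lam ((shift M)^[n] x) ((shift M)^[n] y))
        Filter.atTop (nhds 0)}

/-- The global unstable set `X^u(x) = {y : d_λ(σⁿx, σⁿy) → 0 as n → −∞}`. -/
def globUnstable (lam : ℝ) (x : TMC M) : Set (TMC M) :=
  {y | Filter.Tendsto (fun n : ℕ => dlam lam ((shiftInv M)^[n] x) ((shiftInv M)^[n] y))
        Filter.atTop (nhds 0)}

/-- The (forward) `σ`-orbit of a point. -/
def orbit (q : TMC M) : Set (TMC M) := {y | ∃ k : ℕ, (shift M)^[k] q = y}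

/-- `X^u(Q) = ∪_{q' ∈ Q} X^u(q')` for `Q` the orbit of `q`. -/
def XuQ (lam : ℝ) (q : TMC M) : Set (TMC M) := ⋃ q' ∈ orbit q, globUnstable lam q'

/-- The stable groupoid `G^s(Q) = {(x,y) : x,y ∈ X^u(Q), y ∈ X^s(x)}`. -/
def GsQ (lam : ℝ) (q : TMC M) : Set (TMC M × TMC M) :=
  {a | a.1 ∈ XuQ lam q ∧ a.2 ∈ XuQ lam q ∧ a.2 ∈ globStable lam a.1}

/-- `c_s(a)`: the least `N ≥ 0` with `σ^N(a₂) ∈ X^s(σ^N(a₁), λ⁻¹)`. -/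
noncomputable def cs (lam : ℝ) (a : TMC M × TMC M) : ℕ :=
  sInf {N : ℕ | (shift M)^[N] a.2 ∈ locStable lam ((shift M)^[N] a.1) lam⁻¹}

/-- The stable holonomy map `h^s(z) = σ^{-N}[σ^N(z), σ^N(c₁)]`. -/
noncomputable def holS (N : ℕ) (c₁ z : TMC M) : TMC M :=
  (shiftInv M)^[N] (bracket ((shift M)^[N] z) ((shift M)^[N] c₁))

/-- The base set `V^s(c, η, N) = {(h^s(z), z) : z ∈ X^u(c₂, η)}`. -/
def Vs (lam : ℝ) (c : TMC M × TMC M) (η : ℝ) (N : ℕ) : Set (TMC M × TMC M) :=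
  {b | b.2 ∈ locUnstable lam c.2 η ∧ b.1 = holS N c.1 b.2}

/-- `d_{s,λ}` on the stable groupoid. -/
noncomputable def dsl (lam : ℝ) (a b : TMC M × TMC M) : ℝ :=
  if b.2 ∈ locUnstable lam a.2 lam⁻¹ ∧ b.1 ∈ locUnstable lam a.1 lam⁻¹ then
    max (dlam lam a.1 b.1) (dlam lam a.2 b.2)
  else 1

/-- The groupoid ultrametric `D_{s,λ}`. -/
noncomputable def Dsl (lam : ℝ) (a b : TMC M × TMC M) : ℝ :=
  if cs lam a = cs lam b then dsl lam a b else 1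

/-- The induced metric `D̃_{s,λ}` on the unit space `X^u(Q)`. -/
noncomputable def DslUnits (lam : ℝ) (x y : TMC M) : ℝ :=
  if y ∈ locUnstable lam x lam⁻¹ then dlam lam x y else 1

end TMC

namespace TMC

variable {m : ℕ} {M : Fin m → Fin m → Bool}

theorem ext_apply {x y : TMC M} (h : ∀ i, x.1 i = y.1 i) : x = y :=
  Subtype.ext (funext h)

theorem shift_iterate_apply (k : ℕ) (x : TMC M) (i : ℤ) :
    ((shift M)^[k] x).1 i = x.1 (i + k) := by
  induction k generalizing x with
  | zero => simp
  | succ k ih =>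
    rw [Function.iterate_succ_apply, ih]
    show x.1 (i + k + 1) = _
    push_cast
    rw [add_assoc]

theorem shiftInv_iterate_apply (k : ℕ) (x : TMC M) (i : ℤ) :
    ((shiftInv M)^[k] x).1 i = x.1 (i - k) := by
  induction k generalizing x with
  | zero => simp
  | succ k ih =>
    rw [Function.iterate_succ_apply, ih]
    show x.1 (i - k - 1) = _
    push_cast
    rw [sub_sub]

theorem bracket_apply {x y : TMC M} (h : x.1 0 = y.1 0) (i : ℤ) :
    (bracket x y).1 i = if i ≤ 0 then y.1 i else x.1 i := by
  have hb : bracket x y = ⟨fun n => if n ≤ 0 then y.1 n else x.1 n, _⟩ := dif_pos h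
  rw [hb]

/-- The distance is less than `λ^{-k}` exactly when the central words of radius `k` agree. -/
theorem dlam_lt_zpow_iff {lam : ℝ} (hlam : 1 < lam) (x y : TMC M) (k : ℕ) :
    dlam lam x y < lam ^ (-(k : ℤ)) ↔ ∀ i : ℤ, |i| ≤ k → x.1 i = y.1 i := by
  have hpos : 0 < lam := by linarith
  constructor
  · intro h i hi
    obtain ⟨r, ⟨n, hn, rfl⟩, hr⟩ := exists_lt_of_csInf_lt (by exact ⟨_, 0, by
      intro i hi
      have := abs_nonneg i
      push_cast at hi
      omega, rfl⟩) h
    rw [zpow_lt_zpow_iff_right₀ hlam] at hr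
    exact hn i (by omega)
  · intro h
    refine lt_of_le_of_lt (b := lam ^ (-((k + 1 : ℕ) : ℤ))) (csInf_le ⟨0, ?_⟩ ⟨k + 1, ?_, rfl⟩) ?_
    · rintro r ⟨n, -, rfl⟩
      positivity
    · intro i hi
      exact h i (by push_cast at hi; omega)
    · rw [zpow_lt_zpow_iff_right₀ hlam]
      push_cast
      omega

theorem mem_locUnstable_iff {lam : ℝ} (hlam : 1 < lam) (x y : TMC M) (k : ℕ) :
    y ∈ locUnstable lam x (lam ^ (-(k : ℤ))) ↔ ∀ i : ℤ, i ≤ k → y.1 i = x.1 i := by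
  unfold locUnstable
  rw [Set.mem_ofPred_eq, dlam_lt_zpow_iff hlam]
  constructor
  · rintro ⟨h, hb⟩ i hi
    have h0 : y.1 0 = x.1 0 := (h 0 (by simp)).symm
    by_cases hi0 : i ≤ 0
    · rw [← hb, bracket_apply h0, if_pos hi0]
    · exact (h i (by rw [abs_of_pos (by omega)]; exact hi)).symm
  · intro h
    refine ⟨fun i hi => (h i (le_trans (le_abs_self i) hi)).symm, ext_apply fun i => ?_⟩
    rw [bracket_apply (h 0 (by omega))]
    split_ifs with hi
    · exact (h i (by omega)).symm
    · rfl

theorem mem_locStable_iff {lam : ℝ} (hlam : 1 < lam) (x y : TMC M) (k : ℕ) :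
    y ∈ locStable lam x (lam ^ (-(k : ℤ))) ↔ ∀ i : ℤ, -k ≤ i → x.1 i = y.1 i := by
  unfold locStable
  rw [Set.mem_ofPred_eq, dlam_lt_zpow_iff hlam]
  constructor
  · rintro ⟨h, hb⟩ i hi
    have h0 : x.1 0 = y.1 0 := h 0 (by simp)
    by_cases hi0 : i ≤ 0
    · exact h i (by rw [abs_of_nonpos hi0]; omega)
    · rw [← hb, bracket_apply h0, if_neg hi0]
  · intro h
    refine ⟨fun i hi => h i (abs_le.mp hi).1, ext_apply fun i => ?_⟩
    rw [bracket_apply (h 0 (by omega))]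
    split_ifs with hi
    · rfl
    · exact h i (by omega)

/-- The condition defining `c_s` says that the two sequences agree from index `N - 1` on. -/
theorem shift_iterate_mem_locStable_iff {lam : ℝ} (hlam : 1 < lam) (x y : TMC M) (N : ℕ) :
    (shift M)^[N] y ∈ locStable lam ((shift M)^[N] x) lam⁻¹ ↔
      ∀ i : ℤ, (N : ℤ) - 1 ≤ i → x.1 i = y.1 i := by
  have h := mem_locStable_iff hlam ((shift M)^[N] x) ((shift M)^[N] y) 1
  rw [Nat.cast_one, zpow_neg_one] at h
  rw [h]
  simp only [shift_iterate_apply]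
  constructor
  · intro h i hi
    simpa using h (i - N) (by omega)
  · intro h i hi
    exact h _ (by omega)

theorem apply_eq_of_cs_le {lam : ℝ} (hlam : 1 < lam) {a : TMC M × TMC M}
    (ha : a.2 ∈ globStable lam a.1) {n : ℕ} (hn : cs lam a ≤ n) (i : ℤ) (hi : (n : ℤ) - 1 ≤ i) :
    a.1.1 i = a.2.1 i := by
  have hne : {N : ℕ | (shift M)^[N] a.2 ∈ locStable lam ((shift M)^[N] a.1) lam⁻¹}.Nonempty := by
    have h : ∀ᶠ N : ℕ in Filter.atTop,
        dlam lam ((shift M)^[N] a.1) ((shift M)^[N] a.2) < lam ^ (-((0 : ℕ) : ℤ)) :=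
      Filter.Tendsto.eventually_lt_const (by simp) ha
    obtain ⟨N, hN⟩ := Filter.eventually_atTop.mp h
    refine ⟨N + 1, (shift_iterate_mem_locStable_iff hlam _ _ _).mpr fun i hi => ?_⟩
    push_cast at hi
    have h0 := (dlam_lt_zpow_iff hlam _ _ 0).mp (hN i.toNat (by omega)) 0 (by simp)
    rw [shift_iterate_apply, shift_iterate_apply, zero_add,
      Int.toNat_of_nonneg (by omega)] at h0
    exact h0
  have hmem := (shift_iterate_mem_locStable_iff hlam _ _ _).mp (Nat.sInf_mem hne)
  exact hmem i (by unfold cs at hn; omega)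

theorem holS_apply {N : ℕ} {c z : TMC M} (h : z.1 N = c.1 N) (i : ℤ) :
    (holS N c z).1 i = if i ≤ N then c.1 i else z.1 i := by
  unfold holS
  rw [shiftInv_iterate_apply, bracket_apply (by simpa [shift_iterate_apply] using h)]
  simp [shift_iterate_apply]

theorem dsl_le_of_agree {lam : ℝ} (hlam : 1 < lam) {a b : TMC M × TMC M} {k : ℕ} (hk : 1 ≤ k)
    (h₁ : ∀ i : ℤ, i ≤ k → b.1.1 i = a.1.1 i) (h₂ : ∀ i : ℤ, i ≤ k → b.2.1 i = a.2.1 i) :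
    dsl lam a b ≤ lam ^ (-(k : ℤ)) := by
  have hmem : ∀ x y : TMC M, (∀ i : ℤ, i ≤ k → y.1 i = x.1 i) → y ∈ locUnstable lam x lam⁻¹ := by
    intro x y h
    have := (mem_locUnstable_iff hlam x y 1).mpr fun i hi => h i (by omega)
    rwa [Nat.cast_one, zpow_neg_one] at this
  unfold dsl
  rw [if_pos ⟨hmem _ _ h₂, hmem _ _ h₁⟩]
  exact max_le ((mem_locUnstable_iff hlam _ _ k).mpr h₁).1.le
    ((mem_locUnstable_iff hlam _ _ k).mpr h₂).1.le

/-- An element of the base set agrees with `c` in both coordinates up to index `n + 1`, and its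
coordinates agree with each other from index `n` on. -/
theorem agree_of_mem_Vs {lam : ℝ} (hlam : 1 < lam) {c a : TMC M × TMC M}
    (hc : c.2 ∈ globStable lam c.1) {n : ℕ} (hn : cs lam c ≤ n)
    (ha : a ∈ Vs lam c (lam ^ (-((n + 1 : ℕ) : ℤ))) n) :
    (∀ i : ℤ, i ≤ (n + 1 : ℕ) → a.1.1 i = c.1.1 i) ∧
      (∀ i : ℤ, i ≤ (n + 1 : ℕ) → a.2.1 i = c.2.1 i) ∧
      ∀ i : ℤ, (n : ℤ) ≤ i → a.1.1 i = a.2.1 i := by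
  obtain ⟨h₂, h₁⟩ := ha
  rw [mem_locUnstable_iff hlam] at h₂
  have hcc := apply_eq_of_cs_le hlam hc hn
  have hol := holS_apply (N := n) (c := c.1) (z := a.2)
    ((h₂ n (by omega)).trans (hcc n (by omega)).symm)
  refine ⟨fun i hi => ?_, h₂, fun i hi => ?_⟩
  · rw [h₁, hol]
    split_ifs with h
    · rfl
    · rw [h₂ i hi, hcc i (by omega)]
  · rw [h₁, hol]
    split_ifs with h
    · rw [h₂ i (by omega), hcc i (by omega)]
    · rfl

theorem cs_eq_of_mem_Vs {lam : ℝ} (hlam : 1 < lam) {c a : TMC M × TMC M}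
    (hc : c.2 ∈ globStable lam c.1) {n : ℕ} (hn : cs lam c ≤ n)
    (ha : a ∈ Vs lam c (lam ^ (-((n + 1 : ℕ) : ℤ))) n) : cs lam a = cs lam c := by
  obtain ⟨h₁, h₂, h₃⟩ := agree_of_mem_Vs hlam hc hn ha
  have hcc := apply_eq_of_cs_le hlam hc hn
  have key : ∀ i, a.1.1 i = a.2.1 i ↔ c.1.1 i = c.2.1 i := by
    intro i
    by_cases hi : i ≤ n
    · rw [h₁ i (by omega), h₂ i (by omega)]
    · exact iff_of_true (h₃ i (by omega)) (hcc i (by omega))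
  unfold cs
  simp only [shift_iterate_mem_locStable_iff hlam, key]

end TMC

open TMC in
/-- In an irreducible topological Markov chain with stable groupoid
`G^s(Q)`, for `c ∈ G^s(Q)` and `n ≥ c_s(c)`, any two elements
`a, b ∈ V^s(c, λ^{-n-1}, n)` satisfy `D_{s,λ}(a,b) ≤ λ^{-n-1}`. -/
theorem tmc_baseSet_diameter {m : ℕ} (hm : 1 ≤ m) (M : Fin m → Fin m → Bool)
    (lam : ℝ) (hlam : 1 < lam)
    (hirr : ∀ U V : Set (TMC M), IsOpen U → IsOpen V → U.Nonempty → V.Nonempty →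
      ∃ n : ℕ, ((shift M)^[n] '' U ∩ V).Nonempty)
    (q : TMC M) (hq : ∃ n : ℕ, 1 ≤ n ∧ (shift M)^[n] q = q)
    (c : TMC M × TMC M) (hc : c ∈ GsQ lam q)
    (n : ℕ) (hn : cs lam c ≤ n) :
    ∀ a ∈ Vs lam c (lam ^ (-(n : ℤ) - 1)) n, ∀ b ∈ Vs lam c (lam ^ (-(n : ℤ) - 1)) n,
      Dsl lam a b ≤ lam ^ (-(n : ℤ) - 1) := by
  intro a ha b hb
  have hexp : -(n : ℤ) - 1 = -((n + 1 : ℕ) : ℤ) := by push_cast; ring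
  rw [hexp] at ha hb ⊢
  unfold Dsl
  rw [if_pos ((cs_eq_of_mem_Vs hlam hc.2.2 hn ha).trans (cs_eq_of_mem_Vs hlam hc.2.2 hn hb).symm)]
  obtain ⟨ha₁, ha₂, -⟩ := agree_of_mem_Vs hlam hc.2.2 hn ha
  obtain ⟨hb₁, hb₂, -⟩ := agree_of_mem_Vs hlam hc.2.2 hn hb
  exact dsl_le_of_agree hlam (by omega) (fun i hi => (hb₁ i hi).trans (ha₁ i hi).symm)
    fun i hi => (hb₂ i hi).trans (ha₂ i hi).symm
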